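/- arXiv:1207.0240 — 2 statements merged into one kernel-verified Lean document; each statement's English description precedes it below -/
import Mathlib

section
/- For every real number α > 0, the maximum of (4α + 2)/(2α) and (2α + 2)/2 is at least (3 + √5)/2. -/
/-- For every real number α > 0, the maximum of (4α + 2)/(2α) and (2α + 2)/2
is at least (3 + √5)/2. -/
theorem stmt_0 (α : ℝ) (hα : α > 0) :
    max ((4 * α + 2) / (2 * α)) ((2 * α + 2) / 2) ≥ (3 + Real.sqrt 5) / 2 := by
  have hsq : Real.sqrt 5 ^ 2 = 5 := Real.sq_sqrt (by norm_num)
  have hone : 1 ≤ Real.sqrt 5 := Real.one_le_sqrt.mpr (by norm_num)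
  rcases le_total α ((1 + Real.sqrt 5) / 2) with h | h
  · refine le_max_of_le_left ?_
    rw [le_div_iff₀ (by positivity)]
    nlinarith [mul_le_mul_of_nonneg_left h (sub_nonneg.mpr hone)]
  · refine le_max_of_le_right ?_
    linarith
end

section
/- Let p, q, r be points in a real inner product space, and let λ and R be real numbers with λ > 0, dist(q, r) ≤ λ, dist(p, q) + dist(p, r) + λ ≥ R, and R > 5λ. Then the angle ∠ q p r at p is strictly less than π/6. -/
open Real EuclideanGeometry

/-- If dist(q, r) ≤ λ, dist(p, q) + dist(p, r) + λ ≥ R and R > 5λ with λ > 0,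
then the angle ∠ q p r is strictly less than π/6. -/
theorem stmt_3 {V : Type*} [NormedAddCommGroup V] [InnerProductSpace ℝ V]
    (p q r : V) (lam R : ℝ) (hlam : lam > 0) (hqr : dist q r ≤ lam)
    (hsum : dist p q + dist p r + lam ≥ R) (hR : R > 5 * lam) :
    ∠ q p r < π / 6 := by
  by_contra! hangle
  have hcos : Real.cos (∠ q p r) ≤ √3 / 2 := by
    rw [← Real.cos_pi_div_six]
    exact Real.cos_le_cos_of_nonneg_of_le_pi (by positivity) (angle_le_pi q p r) hangle
  have hlaw := EuclideanGeometry.law_cos q p r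
  rw [dist_comm p q, dist_comm p r] at hsum
  have hq : 0 ≤ dist q p := dist_nonneg
  have hr : 0 ≤ dist r p := dist_nonneg
  have hc : 0 ≤ dist q r := dist_nonneg
  have hsqrt : √3 < 7 / 4 := by
    rw [Real.sqrt_lt' (by norm_num)]
    norm_num
  generalize dist q p = a at *
  generalize dist r p = b at *
  generalize dist q r = c at *
  have hcos' : Real.cos (∠ q p r) ≤ 7 / 8 := by linarith
  have hprod : a * b * Real.cos (∠ q p r) ≤ a * b * (7 / 8) :=
    mul_le_mul_of_nonneg_left hcos' (mul_nonneg hq hr)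
  have hsq : (4 * lam) ^ 2 < (a + b) ^ 2 := by
    apply pow_lt_pow_left₀ <;> linarith
  have hcsq : c ^ 2 ≤ lam ^ 2 := pow_le_pow_left₀ hc hqr 2
  nlinarith [sq_nonneg (a - b)]
end
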